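/- arXiv:2311.02891 — 5 statements merged into one kernel-verified Lean document; each statement's English description precedes it below -/
import Mathlib

section
/- Fix a model f* : X → Ŷ, set the flood levels to θ_i = ℓ(y_i, f*(x_i)) for each i, and let F be a set of models with f* ∈ F. If f̄ ∈ F satisfies L_AdaFlood(f̄) ≤ L_AdaFlood(g) for all g ∈ F, then the empirical losses agree: L(f̄) = L(f*). -/
open Finset

/-- Empirical loss L(f) = (1/N) ∑ᵢ ℓ(yᵢ, f(xᵢ)). -/
noncomputable def empLoss {X Y Yh : Type*} (N : ℕ) (x : Fin N → X) (y : Fin N → Y)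
    (ℓ : Y → Yh → ℝ) (f : X → Yh) : ℝ :=
  (1 / (N : ℝ)) * ∑ i, ℓ (y i) (f (x i))

/-- AdaFlood loss L_AdaFlood(f) = (1/N) ∑ᵢ (|ℓ(yᵢ, f(xᵢ)) − θᵢ| + θᵢ). -/
noncomputable def adaFloodLoss {X Y Yh : Type*} (N : ℕ) (x : Fin N → X) (y : Fin N → Y)
    (ℓ : Y → Yh → ℝ) (θ : Fin N → ℝ) (f : X → Yh) : ℝ :=
  (1 / (N : ℝ)) * ∑ i, (|ℓ (y i) (f (x i)) - θ i| + θ i)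

theorem adaflood_minimizer_emp_loss_eq
    {X Y Yh : Type*} (N : ℕ) (hN : 1 ≤ N) (x : Fin N → X) (y : Fin N → Y)
    (ℓ : Y → Yh → ℝ) (hℓ : ∀ a b, 0 ≤ ℓ a b)
    (fstar : X → Yh) (θ : Fin N → ℝ)
    (hθ : ∀ i, θ i = ℓ (y i) (fstar (x i)))
    (F : Set (X → Yh)) (hF : fstar ∈ F)
    (fbar : X → Yh) (hfbar : fbar ∈ F)
    (hmin : ∀ g ∈ F, adaFloodLoss N x y ℓ θ fbar ≤ adaFloodLoss N x y ℓ θ g) :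
    empLoss N x y ℓ fbar = empLoss N x y ℓ fstar := by
  have h := hmin fstar hF
  unfold adaFloodLoss at h
  have hpos : (0 : ℝ) < 1 / (N : ℝ) := by
    have : (0 : ℝ) < N := by exact_mod_cast hN
    positivity
  have h2 := le_of_mul_le_mul_left h hpos
  have h3 : ∑ i, |ℓ (y i) (fstar (x i)) - θ i| = 0 :=
    Finset.sum_eq_zero fun i _ => by rw [hθ i, sub_self, abs_zero]
  rw [Finset.sum_add_distrib, Finset.sum_add_distrib, h3] at h2
  have h4 : ∑ i, |ℓ (y i) (fbar (x i)) - θ i| = 0 :=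
    le_antisymm (by linarith) (Finset.sum_nonneg fun i _ => abs_nonneg _)
  rw [Finset.sum_eq_zero_iff_of_nonneg (fun i _ => abs_nonneg _)] at h4
  unfold empLoss
  congr 1
  refine Finset.sum_congr rfl fun i hi => ?_
  have h5 := abs_eq_zero.mp (h4 i hi)
  rw [← hθ i]
  linarith
end

section
/- (Main Proposition.) Let F be a set of models with f* ∈ F, set the flood levels to θ_i = ℓ(y_i, f*(x_i)), let ĥ be a minimizer of the empirical loss L over F with L(ĥ) = 0, and let f̄ ∈ F be a minimizer of L_AdaFlood over F. Then: L(ĥ) = 0 ≤ L(f*) = L(f̄), and L_AdaFlood(ĥ) = 2·L(f*) ≥ L(f*) = L_AdaFlood(f*) = L_AdaFlood(f̄). -/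
open Finset

theorem adaflood_main_proposition
    {X Y Yh : Type*} (N : ℕ) (hN : 1 ≤ N) (x : Fin N → X) (y : Fin N → Y)
    (ℓ : Y → Yh → ℝ) (hℓ : ∀ a b, 0 ≤ ℓ a b)
    (F : Set (X → Yh)) (fstar : X → Yh) (hfstar : fstar ∈ F)
    (θ : Fin N → ℝ) (hθ : ∀ i, θ i = ℓ (y i) (fstar (x i)))
    (fhat : X → Yh) (hfhat : fhat ∈ F)
    (hfhatMin : ∀ g ∈ F, empLoss N x y ℓ fhat ≤ empLoss N x y ℓ g)
    (h0 : empLoss N x y ℓ fhat = 0)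
    (fbar : X → Yh) (hfbar : fbar ∈ F)
    (hfbarMin : ∀ g ∈ F, adaFloodLoss N x y ℓ θ fbar ≤ adaFloodLoss N x y ℓ θ g) :
    (empLoss N x y ℓ fhat = 0 ∧
     0 ≤ empLoss N x y ℓ fstar ∧
     empLoss N x y ℓ fstar = empLoss N x y ℓ fbar) ∧
    (adaFloodLoss N x y ℓ θ fhat = 2 * empLoss N x y ℓ fstar ∧
     2 * empLoss N x y ℓ fstar ≥ empLoss N x y ℓ fstar ∧
     empLoss N x y ℓ fstar = adaFloodLoss N x y ℓ θ fstar ∧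
     adaFloodLoss N x y ℓ θ fstar = adaFloodLoss N x y ℓ θ fbar) := by
  have hNpos : (0 : ℝ) < 1 / (N : ℝ) := by
    have : (0 : ℝ) < N := by exact_mod_cast hN
    positivity
  have hstar : empLoss N x y ℓ fstar = adaFloodLoss N x y ℓ θ fstar := by
    simp [empLoss, adaFloodLoss, hθ]
  have hnn : 0 ≤ empLoss N x y ℓ fstar :=
    mul_nonneg hNpos.le (Finset.sum_nonneg fun i _ => hℓ _ _)
  -- the minimizer of the empirical loss has zero loss at each data point
  have hhat : ∀ i, ℓ (y i) (fhat (x i)) = 0 := by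
    have h1 : ∑ i, ℓ (y i) (fhat (x i)) = 0 :=
      (mul_eq_zero.mp h0).resolve_left hNpos.ne'
    have h2 := (Finset.sum_eq_zero_iff_of_nonneg (fun i _ => hℓ _ _)).mp h1
    exact fun i => h2 i (Finset.mem_univ i)
  have hadahat : adaFloodLoss N x y ℓ θ fhat = 2 * empLoss N x y ℓ fstar := by
    have h1 : ∀ i, |ℓ (y i) (fhat (x i)) - θ i| + θ i = 2 * ℓ (y i) (fstar (x i)) := by
      intro i
      rw [hhat i, hθ i, zero_sub, abs_neg, abs_of_nonneg (hℓ _ _)]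
      ring
    simp only [adaFloodLoss, empLoss, h1, ← Finset.mul_sum]
    ring
  -- the AdaFlood minimizer matches the flood levels at each data point
  have hbar : ∀ i, ℓ (y i) (fbar (x i)) = θ i := by
    have h1 := hfbarMin fstar hfstar
    simp only [adaFloodLoss] at h1
    have h2 := le_of_mul_le_mul_left h1 hNpos
    have h3 : ∑ i, |ℓ (y i) (fbar (x i)) - θ i| ≤ 0 := by
      simp only [Finset.sum_add_distrib, ← hθ, sub_self, abs_zero, Finset.sum_const_zero] at h2
      linarith
    have h4 := (Finset.sum_eq_zero_iff_of_nonneg (fun i _ => abs_nonneg _)).mp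
      (le_antisymm h3 (Finset.sum_nonneg fun i _ => abs_nonneg _))
    exact fun i => sub_eq_zero.mp (abs_eq_zero.mp (h4 i (Finset.mem_univ i)))
  refine ⟨⟨h0, hnn, ?_⟩, hadahat, by linarith, hstar, ?_⟩
  · simp only [empLoss, hbar, ← hθ]
  · simp only [adaFloodLoss, hbar, ← hθ]
end

section
/- Fix a model f* : X → Ŷ and set the flood levels to θ_i = ℓ(y_i, f*(x_i)). If ĥ : X → Ŷ satisfies L(ĥ) = 0 and L(f*) > 0, then L_AdaFlood(ĥ) > L_AdaFlood(f*); that is, the zero-training-loss interpolator is strictly suboptimal for the AdaFlood objective. -/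
open Finset

theorem interpolator_strictly_suboptimal
    {X Y Yh : Type*} (N : ℕ) (hN : 1 ≤ N) (x : Fin N → X) (y : Fin N → Y)
    (ℓ : Y → Yh → ℝ) (hℓ : ∀ a b, 0 ≤ ℓ a b)
    (fstar : X → Yh) (θ : Fin N → ℝ)
    (hθ : ∀ i, θ i = ℓ (y i) (fstar (x i)))
    (fhat : X → Yh) (h0 : empLoss N x y ℓ fhat = 0)
    (hpos : 0 < empLoss N x y ℓ fstar) :
    adaFloodLoss N x y ℓ θ fstar < adaFloodLoss N x y ℓ θ fhat := by
  have hc : 0 < 1 / (N : ℝ) := by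
    have : (0 : ℝ) < N := by exact_mod_cast hN
    positivity
  unfold empLoss at h0 hpos
  unfold adaFloodLoss
  have hs0 : ∑ i, ℓ (y i) (fhat (x i)) = 0 :=
    (mul_eq_zero.mp h0).resolve_left hc.ne'
  have hsp : 0 < ∑ i, ℓ (y i) (fstar (x i)) := (mul_pos_iff_of_pos_left hc).mp hpos
  apply mul_lt_mul_of_pos_left _ hc
  have h1 : ∑ i, (|ℓ (y i) (fstar (x i)) - θ i| + θ i) = ∑ i, ℓ (y i) (fstar (x i)) :=
    Finset.sum_congr rfl fun i _ => by simp [hθ i]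
  have h2 : ∑ i, (2 * ℓ (y i) (fstar (x i)) - ℓ (y i) (fhat (x i)))
      ≤ ∑ i, (|ℓ (y i) (fhat (x i)) - θ i| + θ i) :=
    Finset.sum_le_sum fun i _ => by
      have := neg_le_abs (ℓ (y i) (fhat (x i)) - θ i)
      have := hθ i
      linarith
  rw [Finset.sum_sub_distrib, ← Finset.mul_sum] at h2
  linarith
end

section
/- (Overestimated flood levels.) Fix a model f* : X → Ŷ and set the flood levels to θ_i = 2 · ℓ(y_i, f*(x_i)) for each i. If ĥ : X → Ŷ satisfies L(ĥ) = 0, then L_AdaFlood(ĥ) = 4 · L(f*) and L_AdaFlood(f*) = 3 · L(f*); in particular L_AdaFlood(ĥ) ≥ L_AdaFlood(f*). -/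
open Finset

theorem overestimated_flood_levels
    {X Y Yh : Type*} (N : ℕ) (hN : 1 ≤ N) (x : Fin N → X) (y : Fin N → Y)
    (ℓ : Y → Yh → ℝ) (hℓ : ∀ a b, 0 ≤ ℓ a b)
    (fstar : X → Yh) (θ : Fin N → ℝ)
    (hθ : ∀ i, θ i = 2 * ℓ (y i) (fstar (x i)))
    (fhat : X → Yh) (h0 : empLoss N x y ℓ fhat = 0) :
    adaFloodLoss N x y ℓ θ fhat = 4 * empLoss N x y ℓ fstar ∧
    adaFloodLoss N x y ℓ θ fstar = 3 * empLoss N x y ℓ fstar ∧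
    adaFloodLoss N x y ℓ θ fstar ≤ adaFloodLoss N x y ℓ θ fhat := by
  have hNpos : (0 : ℝ) < N := by exact_mod_cast hN
  have hz : ∀ i, ℓ (y i) (fhat (x i)) = 0 := by
    have hs : ∑ i, ℓ (y i) (fhat (x i)) = 0 := by
      unfold empLoss at h0
      rcases mul_eq_zero.mp h0 with h | h
      · exact absurd h (by positivity)
      · exact h
    intro i
    exact (Finset.sum_eq_zero_iff_of_nonneg (fun j _ => hℓ _ _)).mp hs i (Finset.mem_univ i)
  have h1 : adaFloodLoss N x y ℓ θ fhat = 4 * empLoss N x y ℓ fstar := by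
    unfold adaFloodLoss empLoss
    rw [mul_left_comm, Finset.mul_sum (a := (4 : ℝ))]
    congr 1
    refine Finset.sum_congr rfl fun i _ => ?_
    have h := hℓ (y i) (fstar (x i))
    rw [hz i, hθ i, abs_of_nonpos (by linarith)]
    ring
  have h2 : adaFloodLoss N x y ℓ θ fstar = 3 * empLoss N x y ℓ fstar := by
    unfold adaFloodLoss empLoss
    rw [mul_left_comm, Finset.mul_sum (a := (3 : ℝ))]
    congr 1
    refine Finset.sum_congr rfl fun i _ => ?_
    have h := hℓ (y i) (fstar (x i))
    rw [hθ i, abs_of_nonpos (by linarith)]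
    ring
  have h3 : 0 ≤ empLoss N x y ℓ fstar := by
    unfold empLoss
    exact mul_nonneg (by positivity) (Finset.sum_nonneg fun i _ => hℓ _ _)
  exact ⟨h1, h2, by linarith⟩
end

section
/- (Underestimated flood levels.) Fix a model f* : X → Ŷ and set the flood levels to θ_i = (1/2) · ℓ(y_i, f*(x_i)) for each i. If ĥ : X → Ŷ satisfies L(ĥ) = 0, then L_AdaFlood(ĥ) = L(f*) = L_AdaFlood(f*). -/
open Finset

theorem underestimated_flood_levels
    {X Y Yh : Type*} (N : ℕ) (hN : 1 ≤ N) (x : Fin N → X) (y : Fin N → Y)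
    (ℓ : Y → Yh → ℝ) (hℓ : ∀ a b, 0 ≤ ℓ a b)
    (fstar : X → Yh) (θ : Fin N → ℝ)
    (hθ : ∀ i, θ i = (1 / 2) * ℓ (y i) (fstar (x i)))
    (fhat : X → Yh) (h0 : empLoss N x y ℓ fhat = 0) :
    adaFloodLoss N x y ℓ θ fhat = empLoss N x y ℓ fstar ∧
    empLoss N x y ℓ fstar = adaFloodLoss N x y ℓ θ fstar := by
  have hN' : (1 / (N : ℝ)) ≠ 0 := by
    have : (N : ℝ) ≠ 0 := by
      exact_mod_cast (by omega : N ≠ 0)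
    exact one_div_ne_zero this
  have hs : ∑ i, ℓ (y i) (fhat (x i)) = 0 := by
    unfold empLoss at h0
    exact (mul_eq_zero.mp h0).resolve_left hN'
  have hz : ∀ i, ℓ (y i) (fhat (x i)) = 0 := fun i =>
    (Finset.sum_eq_zero_iff_of_nonneg (fun i _ => hℓ _ _)).mp hs i (Finset.mem_univ i)
  unfold adaFloodLoss empLoss
  constructor
  · congr 1
    refine Finset.sum_congr rfl fun i _ => ?_
    have h := hℓ (y i) (fstar (x i))
    rw [hz i, hθ i, abs_of_nonpos (by linarith)]
    ring
  · congr 1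
    refine Finset.sum_congr rfl fun i _ => ?_
    have h := hℓ (y i) (fstar (x i))
    rw [hθ i, abs_of_nonneg (by linarith)]
    ring
end
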